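/- Let X_1,…,X_k (k ≥ 2) be deep sets of nodes of a tree T and let j with 1 ≤ j ≤ k be fixed. Define U_j = {(r,r) : r ∈ X_j} and, for i = j+1,…,k, U_i = MopRight(U_{i-1}, X_i). Then for every l with j+1 ≤ l ≤ k we have U_l = mop(X_j,…,X_l). Moreover, setting V_j = U_k and, for i = j-1 down to 1, V_i = MopLeft(X_i, V_{i+1}), we have V_l = mop(X_l,…,X_k) for every l with 1 ≤ l ≤ j-1. -/

import Mathlib

namespace TreeIncl

/-- Rooted, ordered, labeled trees: a label and an ordered list of children. -/
inductive OTree (α : Type) : Type where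
  | node : α → List (OTree α) → OTree α

namespace OTree

variable {α β : Type}

/-- The label of the root. -/
def label : OTree α → α
  | node a _ => a

/-- The (ordered) children subtrees of the root. -/
def children : OTree α → List (OTree α)
  | node _ cs => cs

/-- Nodes are identified with positions: lists of child indices from the root. -/
abbrev Node : Type := List ℕ

/-- The subtree rooted at a given position, if the position is valid. -/
def sub : Node → OTree α → Option (OTree α)
  | [], t => some t
  | i :: p, t =>
    match t.children[i]? with
    | some c => sub p c
    | none => none

/-- The set `V(T)` of (positions of) nodes of a tree. -/
def Pos (t : OTree α) : Set Node := {p | sub p t ≠ none}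

/-- The label of the node at position `p`. -/
def labelAt (t : OTree α) (p : Node) : Option α := (sub p t).map label

/-- `l_T`: the number of leaves of a tree. -/
def numLeaves : OTree α → ℕ
  | node _ [] => 1
  | node a (c :: cs) => numLeaves c + numLeaves (node a cs)

/-- `n_T`: the number of nodes of a tree. -/
def numNodes : OTree α → ℕ
  | node _ [] => 1
  | node a (c :: cs) => numNodes c + numNodes (node a cs)

/-- The number of leaves of the subtree rooted at position `p` (0 if `p` is invalid). -/
def leavesAt (t : OTree α) (p : Node) : ℕ := ((sub p t).map numLeaves).getD 0

/-- `v ⪯ w` : `v` is an ancestor of `w` (positions: prefix). -/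
def Anc (v w : Node) : Prop := v <+: w

/-- `v ≺ w` : `v` is a proper ancestor of `w` (positions: strict prefix). -/
def SAnc (v w : Node) : Prop := v <+: w ∧ v ≠ w

/-- `u ◁ w` : `u` is to the left of `w`
    (equivalently: `pre(u) < pre(w)` and `post(u) < post(w)`). -/
def LeftOf (u w : Node) : Prop :=
  ∃ (q : Node) (i j : ℕ) (u' w' : Node), i < j ∧ u = q ++ i :: u' ∧ w = q ++ j :: w'

/-- `u ⊴ w` : `u ◁ w` or `u ⪯ w` or `w ≺ u`. -/
def LeftOrAbove (u w : Node) : Prop := LeftOf u w ∨ Anc u w ∨ SAnc w u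

/-- The nearest common ancestor of two positions: longest common prefix. -/
def nca : Node → Node → Node
  | [], _ => []
  | _, [] => []
  | i :: u, j :: w => if i = j then i :: nca u w else []

/-- A set of nodes is deep: no node is a proper ancestor of another node in the set. -/
def DeepSet (X : Set Node) : Prop := ∀ x ∈ X, ∀ y ∈ X, ¬ SAnc x y

/-- `Deep(X)`: the elements of `X` having no proper descendant in `X`. -/
def DeepOf (X : Set Node) : Set Node := {x | x ∈ X ∧ ¬ ∃ z ∈ X, SAnc x z}

/-- `Φ(X_1, …, X_k)`: xs is a tuple with `x_i ∈ X_i` and `x_1 ◁ x_2 ◁ ⋯ ◁ x_k`. -/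
def Phi (Xs : List (Set Node)) (xs : List Node) : Prop :=
  List.Forall₂ (fun x X => x ∈ X) xs Xs ∧ xs.Chain' LeftOf

/-- `mop(X_1, …, X_k)`: the set of minimum ordered pairs. -/
def Mop (Xs : List (Set Node)) : Set (Node × Node) :=
  {p | (∃ xs, Phi Xs xs ∧ xs.head? = some p.1 ∧ xs.getLast? = some p.2) ∧
    ¬ ∃ ys y1 yk, Phi Xs ys ∧ ys.head? = some y1 ∧ ys.getLast? = some yk ∧
      ((LeftOf p.1 y1 ∧ LeftOf y1 yk ∧ LeftOrAbove yk p.2) ∨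
       (LeftOrAbove p.1 y1 ∧ LeftOf y1 yk ∧ LeftOf yk p.2))}

/-- `MopRight(Y, X)`: for `(y₁,y₂) ∈ Y`, `(y₁,x)` is in the result iff
    `(y₂,x) ∈ mop(Y|₂, X)`. -/
def MopRight (Y : Set (Node × Node)) (X : Set Node) : Set (Node × Node) :=
  {r | ∃ y2, (r.1, y2) ∈ Y ∧ (y2, r.2) ∈ Mop [Prod.snd '' Y, X]}

/-- `MopLeft(X, Y)`: for `(y₁,y₂) ∈ Y`, `(x,y₂)` is in the result iff
    `(x,y₁) ∈ mop(X, Y|₁)`. -/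
def MopLeft (X : Set Node) (Y : Set (Node × Node)) : Set (Node × Node) :=
  {r | ∃ y1, (y1, r.2) ∈ Y ∧ (r.1, y1) ∈ Mop [X, Prod.fst '' Y]}

/-- One deletion step: delete a node of the tree, making its children children of its
parent (in its place, in order); the root may be deleted when it has exactly one
child. -/
inductive DelStep : OTree α → OTree α → Prop
  | root (a : α) (t : OTree α) : DelStep (node a [t]) t
  | splice (a b : α) (pre cs post : List (OTree α)) :
      DelStep (node a (pre ++ node b cs :: post)) (node a (pre ++ cs ++ post))
  | congr (a : α) (pre post : List (OTree α)) {t t' : OTree α} :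
      DelStep t t' → DelStep (node a (pre ++ t :: post)) (node a (pre ++ t' :: post))

/-- `P ⊑ T` : `P` can be obtained from `T` by deleting nodes of `T`. -/
def Included (P T : OTree α) : Prop := Relation.ReflTransGen (fun x y => DelStep x y) T P

/-- An embedding of `P` in `T`: an injective map of nodes preserving labels,
    proper ancestorship, and the left-of relation. -/
structure IsEmb (P T : OTree α) (f : Node → Node) : Prop where
  mem : ∀ p ∈ Pos P, f p ∈ Pos T
  inj : ∀ p ∈ Pos P, ∀ q ∈ Pos P, f p = f q → p = q
  lab : ∀ p ∈ Pos P, labelAt T (f p) = labelAt P p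
  anc : ∀ p ∈ Pos P, ∀ q ∈ Pos P, (SAnc p q ↔ SAnc (f p) (f q))
  ord : ∀ p ∈ Pos P, ∀ q ∈ Pos P, (LeftOf p q ↔ LeftOf (f p) (f q))

/-- A deep embedding: no other embedding maps the root of `P` strictly deeper. -/
def IsDeepEmb (P T : OTree α) (f : Node → Node) : Prop :=
  IsEmb P T f ∧ ¬ ∃ g, IsEmb P T g ∧ SAnc (f []) (g [])

/-- `emb(P,T)`: the set of deep occurrences of `P` in `T`. -/
def emb (P T : OTree α) : Set Node := {w | ∃ f, IsDeepEmb P T f ∧ f [] = w}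

/-- `FlAt T x a q` : `q = fl(x, a)`, the first ancestor of `x` labeled `a` in `T`. -/
def FlAt (t : OTree α) (x : Node) (a : α) (q : Node) : Prop :=
  q <+: x ∧ labelAt t q = some a ∧ ∀ r, SAnc q r → r <+: x → labelAt t r ≠ some a

/-! ### Heavy leaf path decompositions -/

/-- `hv` is a heavy leaf path decomposition of `P`: for each internal node (position)
`p`, `hv p` is the index of a child with the maximum number of descendant leaves. -/
def IsHeavyDecomp (P : OTree α) (hv : Node → ℕ) : Prop :=
  ∀ p s, sub p P = some s → s.children ≠ [] →
    ∃ c, s.children[hv p]? = some c ∧ ∀ c' ∈ s.children, numLeaves c' ≤ numLeaves c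

/-- `ldepth(v)`: the number of light edges on the path from the root to `v`. -/
def ldepth (hv : Node → ℕ) (v : Node) : ℕ :=
  (List.range v.length).countP (fun n => v.getD n 0 != hv (v.take n))

/-- The light nodes on the path from the root to `v`, ordered by increasing depth
    (the root is light; a nonroot node is light iff it is not the heavy child
    of its parent). -/
def lightPrefixes (hv : Node → ℕ) (v : Node) : List Node :=
  ((List.range (v.length + 1)).map (fun n => v.take n)).filter
    (fun q => q.getLast? != some (hv q.dropLast))

/-- The position of `heavy(parent(q))` for a nonroot position `q`. -/
def heavySibPos (hv : Node → ℕ) (q : Node) : Node :=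
  q.dropLast ++ [hv q.dropLast]

/-! ### Clusters -/

/-- Two positions are adjacent in the tree (parent/child). -/
def Adj (u v : Node) : Prop := (∃ i, v = u ++ [i]) ∨ (∃ i, u = v ++ [i])

/-- `S` is (the vertex set of) a nonempty connected subgraph of `T`. -/
def Conn (T : OTree α) (S : Set Node) : Prop :=
  S.Nonempty ∧ S ⊆ Pos T ∧
    ∀ u ∈ S, ∀ v ∈ S, ∀ w, nca u v <+: w → (w <+: u ∨ w <+: v) → w ∈ S

/-- The boundary nodes of a connected subgraph `S` of `T`: nodes of `S` adjacent to a
node of `T` outside `S`, together with the root of `T` if it lies in `S`. -/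
def Boundary (T : OTree α) (S : Set Node) : Set Node :=
  {v ∈ S | (∃ u ∈ Pos T, u ∉ S ∧ Adj v u) ∨ v = []}

/-- The edges of `T` joining two nodes of `S`. -/
def EdgesIn (T : OTree α) (S : Set Node) : Set (Node × Node) :=
  {e | e.1 ∈ S ∧ e.2 ∈ S ∧ e.2 ∈ Pos T ∧ ∃ i, e.2 = e.1 ++ [i]}

/-- A cluster of `T`: a connected subgraph with at most two boundary nodes. -/
def IsCluster (T : OTree α) (S : Set Node) : Prop :=
  Conn T S ∧ (Boundary T S).encard ≤ 2

/-- A cluster partition of `T`. -/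
structure IsClusterPartition (T : OTree α) (CS : List (Set Node)) : Prop where
  cluster : ∀ S ∈ CS, IsCluster T S
  coverV : ∀ p ∈ Pos T, ∃ S ∈ CS, p ∈ S
  coverE : ∀ e ∈ EdgesIn T (Pos T), ∃ S ∈ CS, e ∈ EdgesIn T S
  disjE : CS.Pairwise (fun S₁ S₂ => EdgesIn T S₁ ∩ EdgesIn T S₂ = ∅)
  edge : ∀ S ∈ CS, (EdgesIn T S).Nonempty

/-- Binary tree: every node has at most two children. -/
def IsBinary (t : OTree α) : Prop := ∀ p s, sub p t = some s → s.children.length ≤ 2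

/-- Relabeling of a tree. -/
def omap (f : α → β) : OTree α → OTree β
  | node a cs => node (f a) (cs.attach.map (fun c => omap f c.1))
termination_by t => sizeOf t
decreasing_by
  have := List.sizeOf_lt_of_mem c.2
  simp only [OTree.node.sizeOf_spec]
  omega


/-! ### Minimal pairs of a relation -/

/-- The pair `(c, d)` lies inside `(a, b)` and differs from it, with respect to the
order `lt`. -/
def Narrower {N : Type*} (lt : N → N → Prop) (a b c d : N) : Prop :=
  (lt a c ∧ (lt d b ∨ d = b)) ∨ ((lt a c ∨ a = c) ∧ lt d b)

/-- `(a, b)` is related by `R`, and no narrower pair is. -/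
def IsMinPair {N : Type*} (lt R : N → N → Prop) (a b : N) : Prop :=
  R a b ∧ ∀ c d, R c d → ¬ Narrower lt a b c d

theorem narrower_flip {N : Type*} (lt : N → N → Prop) (a b c d : N) :
    Narrower (flip lt) b a d c ↔ Narrower lt a b c d := by
  simp only [Narrower, flip, eq_comm (a := c), eq_comm (a := d)]
  tauto

theorem isMinPair_flip {N : Type*} (lt R : N → N → Prop) (a b : N) :
    IsMinPair (flip lt) (flip R) b a ↔ IsMinPair lt R a b := by
  simp only [IsMinPair, narrower_flip]
  exact and_congr_right fun _ => forall_comm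

/-- If only finitely many pairs are related, every related pair contains a minimal one. -/
theorem exists_isMinPair {N : Type*} {lt R : N → N → Prop}
    (htrans : ∀ {a b c}, lt a b → lt b c → lt a c) (hirr : ∀ a, ¬ lt a a)
    (hfin : {p : N × N | R p.1 p.2}.Finite) {a b : N} (hab : R a b) :
    ∃ c d, IsMinPair lt R c d ∧ (lt a c ∨ a = c) ∧ (lt d b ∨ d = b) := by
  let r : N × N → N × N → Prop := fun q p => Narrower lt p.1 p.2 q.1 q.2
  have : IsStrictOrder (N × N) r :=
    { irrefl := by
        intro p hp
        rcases hp with ⟨h, -⟩ | ⟨-, h⟩ <;> exact hirr _ h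
      trans := by
        intro p q s hpq hqs
        simp only [r, Narrower] at *
        grind }
  refine (hfin.wellFoundedOn (r := r)).induction (x := (a, b)) hab
    (P := fun p => ∃ c d, IsMinPair lt R c d ∧ (lt p.1 c ∨ p.1 = c) ∧ (lt d p.2 ∨ d = p.2)) ?_
  rintro ⟨a, b⟩ hR ih
  by_cases hmin : IsMinPair lt R a b
  · exact ⟨a, b, hmin, .inr rfl, .inr rfl⟩
  · obtain ⟨a', b', hR', hn⟩ : ∃ a' b', R a' b' ∧ Narrower lt a b a' b' := by
      by_contra! h
      exact hmin ⟨hR, h⟩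
    obtain ⟨c, d, hm, hc, hd⟩ := ih (a', b') hR' hn
    refine ⟨c, d, hm, ?_⟩
    simp only [Narrower] at hn
    grind

theorem isMinPair_comp_right {N : Type*} {lt R : N → N → Prop} {C : N → Prop}
    (htrans : ∀ {a b c}, lt a b → lt b c → lt a c) (hirr : ∀ a, ¬ lt a a)
    (hfin : {p : N × N | R p.1 p.2}.Finite)
    (hfst : ∀ {a b c d}, R a b → R c d → lt a c ∨ a = c ∨ lt c a)
    (hsnd : ∀ {a b c d}, R a b → R c d → lt b d ∨ b = d ∨ lt d b) (a c : N) :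
    IsMinPair lt (fun a c => ∃ b, R a b ∧ C c ∧ lt b c) a c ↔
      ∃ b, IsMinPair lt R a b ∧
        IsMinPair lt (fun b c => (∃ a, IsMinPair lt R a b) ∧ C c ∧ lt b c) b c := by
  constructor
  · rintro ⟨⟨b, hab, hc, hbc⟩, hmin⟩
    obtain ⟨a', b', hm, ha, hb⟩ := exists_isMinPair (lt := lt) htrans hirr hfin hab
    have hb'c : lt b' c := hb.elim (fun h => htrans h hbc) (fun h => h ▸ hbc)
    obtain rfl : a = a' := ha.resolve_left fun h =>
      hmin a' c ⟨b', hm.1, hc, hb'c⟩ (.inl ⟨h, .inr rfl⟩)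
    refine ⟨b', hm, ⟨⟨a, hm⟩, hc, hb'c⟩, ?_⟩
    rintro b'' c'' ⟨⟨a'', hm''⟩, hc'', hlt⟩ hn
    have hmin' := hmin a'' c'' ⟨b'', hm''.1, hc'', hlt⟩
    have hno := hm''.2 a b' hm.1
    have htri := hfst hm.1 hm''.1
    simp only [Narrower] at hn hmin' hno
    grind
  · rintro ⟨b, hm, ⟨-, hc, hbc⟩, hmin⟩
    refine ⟨⟨b, hm.1, hc, hbc⟩, ?_⟩
    rintro a₀ c' ⟨b₀, hR, hc', hlt₀⟩ hn
    obtain ⟨a', b', hm', ha, hb⟩ := exists_isMinPair (lt := lt) htrans hirr hfin hR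
    have hlt : lt b' c' := hb.elim (fun h => htrans h hlt₀) (fun h => h ▸ hlt₀)
    have hmin' := hmin b' c' ⟨⟨a', hm'⟩, hc', hlt⟩
    have hno := hm.2 a' b' hm'.1
    have htri := hsnd hm.1 hm'.1
    simp only [Narrower] at hn hmin' hno
    grind

theorem isMinPair_comp_left {N : Type*} {lt R : N → N → Prop} {C : N → Prop}
    (htrans : ∀ {a b c}, lt a b → lt b c → lt a c) (hirr : ∀ a, ¬ lt a a)
    (hfin : {p : N × N | R p.1 p.2}.Finite)
    (hfst : ∀ {a b c d}, R a b → R c d → lt a c ∨ a = c ∨ lt c a)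
    (hsnd : ∀ {a b c d}, R a b → R c d → lt b d ∨ b = d ∨ lt d b) (c b : N) :
    IsMinPair lt (fun c b => ∃ a, R a b ∧ C c ∧ lt c a) c b ↔
      ∃ a, IsMinPair lt R a b ∧
        IsMinPair lt (fun c a => (∃ b, IsMinPair lt R a b) ∧ C c ∧ lt c a) c a := by
  have hfin' : {p : N × N | flip R p.1 p.2}.Finite :=
    (hfin.image Prod.swap).subset fun p hp => ⟨p.swap, hp, p.swap_swap⟩
  have key := isMinPair_comp_right (lt := flip lt) (R := flip R) (C := C)
    (fun h h' => htrans h' h) hirr hfin'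
    (fun h h' => by have := hsnd h h'; simp only [flip]; tauto)
    (fun h h' => by have := hfst h h'; simp only [flip]; tauto) b c
  simp only [isMinPair_flip] at key
  rw [← isMinPair_flip]
  refine key.trans (exists_congr fun a => and_congr_right fun _ => ?_)
  rw [← isMinPair_flip]
  rfl

/-! ### The left-of relation -/

@[simp]
theorem not_leftOf_nil_left (w : Node) : ¬ LeftOf [] w := by
  rintro ⟨q, i, j, u, v, -, h, -⟩
  simp at h

@[simp]
theorem not_leftOf_nil_right (w : Node) : ¬ LeftOf w [] := by
  rintro ⟨q, i, j, u, v, -, -, h⟩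
  simp at h

@[simp]
theorem leftOf_cons_cons (i j : ℕ) (u w : Node) :
    LeftOf (i :: u) (j :: w) ↔ i < j ∨ i = j ∧ LeftOf u w := by
  constructor
  · rintro ⟨_ | ⟨m, q⟩, i', j', u', w', h, h₁, h₂⟩
    · grind
    · simp only [List.cons_append, List.cons.injEq] at h₁ h₂
      exact .inr ⟨h₁.1.trans h₂.1.symm, q, i', j', u', w', h, h₁.2, h₂.2⟩
  · rintro (h | ⟨rfl, q, i', j', u', w', h, rfl, rfl⟩)
    · exact ⟨[], i, j, u, w, h, rfl, rfl⟩
    · exact ⟨i :: q, i', j', u', w', h, rfl, rfl⟩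

theorem not_leftOf_self (u : Node) : ¬ LeftOf u u := by
  induction u with
  | nil => simp
  | cons i u ih => simp [ih]

theorem LeftOf.trans {u v w : Node} (huv : LeftOf u v) (hvw : LeftOf v w) : LeftOf u w := by
  induction u generalizing v w with
  | nil => simp at huv
  | cons i u ih =>
    cases v with
    | nil => simp at huv
    | cons j v =>
      cases w with
      | nil => simp at hvw
      | cons m w =>
        rw [leftOf_cons_cons] at huv hvw ⊢
        grind

theorem leftOf_trichotomy (u w : Node) :
    LeftOf u w ∨ LeftOf w u ∨ u <+: w ∨ w <+: u := by
  induction u generalizing w with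
  | nil => simp
  | cons i u ih =>
    cases w with
    | nil => simp
    | cons j w =>
      simp only [leftOf_cons_cons, List.cons_prefix_cons]
      have := ih w
      rcases lt_trichotomy i j with h | rfl | h <;> tauto

theorem DeepSet.leftOf_trichotomy {X : Set Node} (hX : DeepSet X) {x y : Node} (hx : x ∈ X)
    (hy : y ∈ X) : LeftOf x y ∨ x = y ∨ LeftOf y x := by
  have h₁ := hX x hx y hy
  have h₂ := hX y hy x hx
  have := OTree.leftOf_trichotomy x y
  simp only [SAnc] at h₁ h₂
  grind

theorem DeepSet.leftOrAbove_iff {X : Set Node} (hX : DeepSet X) {x y : Node} (hx : x ∈ X)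
    (hy : y ∈ X) : LeftOrAbove x y ↔ LeftOf x y ∨ x = y := by
  have h₁ := hX x hx y hy
  have h₂ := hX y hy x hx
  have h₃ : x = y → x <+: y := fun h => h ▸ List.prefix_rfl
  simp only [LeftOrAbove, SAnc, Anc] at h₁ h₂ ⊢
  grind

/-! ### End points of increasing tuples -/

/-- `a` and `b` are the first and the last entry of some tuple in `Φ(Xs)`. -/
def Spans (Xs : List (Set Node)) (a b : Node) : Prop :=
  ∃ xs, Phi Xs xs ∧ xs.head? = some a ∧ xs.getLast? = some b

theorem spans_singleton (X : Set Node) (a b : Node) : Spans [X] a b ↔ a ∈ X ∧ b = a := by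
  constructor
  · rintro ⟨xs, ⟨hm, -⟩, ha, hb⟩
    obtain ⟨x, l, hx, hl, rfl⟩ := List.forall₂_cons_right_iff.1 hm
    obtain rfl := List.forall₂_nil_right_iff.1 hl
    simp only [List.head?_cons, List.getLast?_singleton, Option.some.injEq] at ha hb
    subst ha hb
    exact ⟨hx, rfl⟩
  · rintro ⟨ha, rfl⟩
    exact ⟨[b], ⟨by simpa using ha, List.isChain_singleton b⟩, rfl, rfl⟩

theorem Spans.mem_head {X : Set Node} {Xs : List (Set Node)} {a b : Node}
    (h : Spans (X :: Xs) a b) : a ∈ X := by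
  obtain ⟨xs, ⟨hm, -⟩, ha, -⟩ := h
  obtain ⟨x, l, hx, -, rfl⟩ := List.forall₂_cons_right_iff.1 hm
  simp only [List.head?_cons, Option.some.injEq] at ha
  exact ha ▸ hx

theorem spans_cons {Xs : List (Set Node)} (hXs : Xs ≠ []) (C : Set Node) (c b : Node) :
    Spans (C :: Xs) c b ↔ ∃ a, Spans Xs a b ∧ c ∈ C ∧ LeftOf c a := by
  constructor
  · rintro ⟨xs, ⟨hm, hch⟩, hc, hb⟩
    obtain ⟨x, l, hx, hl, rfl⟩ := List.forall₂_cons_right_iff.1 hm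
    obtain ⟨Y, Ys, rfl⟩ := List.exists_cons_of_ne_nil hXs
    obtain ⟨y, l', hy, hl', rfl⟩ := List.forall₂_cons_right_iff.1 hl
    obtain ⟨hlt, hch'⟩ := List.isChain_cons_cons.1 hch
    simp only [List.head?_cons, Option.some.injEq] at hc
    subst hc
    exact ⟨y, ⟨_, ⟨hl, hch'⟩, rfl, by rwa [List.getLast?_cons_cons] at hb⟩, hx, hlt⟩
  · rintro ⟨a, ⟨xs, ⟨hm, hch⟩, ha, hb⟩, hc, hlt⟩
    cases xs with
    | nil => simp at ha
    | cons x xs =>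
      simp only [List.head?_cons, Option.some.injEq] at ha
      subst ha
      exact ⟨c :: x :: xs, ⟨.cons hc hm, List.isChain_cons_cons.2 ⟨hlt, hch⟩⟩, rfl,
        by rwa [List.getLast?_cons_cons]⟩

theorem spans_append {Xs : List (Set Node)} (hXs : Xs ≠ []) (C : Set Node) (a c : Node) :
    Spans (Xs ++ [C]) a c ↔ ∃ b, Spans Xs a b ∧ c ∈ C ∧ LeftOf b c := by
  induction Xs generalizing a with
  | nil => exact absurd rfl hXs
  | cons X Xs ih =>
    rcases eq_or_ne Xs [] with rfl | hne
    · simp only [List.cons_append, List.nil_append, spans_singleton,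
        spans_cons (List.cons_ne_nil C [])]
      grind
    · rw [List.cons_append, spans_cons (by simp)]
      simp only [ih hne, spans_cons hne]
      grind

theorem Spans.mem_getLast {X : Set Node} {Xs : List (Set Node)} {a b : Node}
    (h : Spans (Xs ++ [X]) a b) : b ∈ X := by
  rcases eq_or_ne Xs [] with rfl | hne
  · obtain ⟨h, rfl⟩ := (spans_singleton X a b).1 h
    exact h
  · obtain ⟨-, -, h, -⟩ := (spans_append hne X a b).1 h
    exact h

theorem Spans.leftOf {X : Set Node} {Xs : List (Set Node)} (hXs : Xs ≠ []) {a b : Node}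
    (h : Spans (X :: Xs) a b) : LeftOf a b := by
  induction Xs generalizing X a with
  | nil => exact absurd rfl hXs
  | cons Y Ys ih =>
    obtain ⟨c, hc, -, hlt⟩ := (spans_cons hXs X a b).1 h
    rcases eq_or_ne Ys [] with rfl | hne
    · obtain ⟨-, rfl⟩ := (spans_singleton Y c b).1 hc
      exact hlt
    · exact hlt.trans (ih hne hc)

theorem Spans.ne_nil {Xs : List (Set Node)} {a b : Node} (h : Spans Xs a b) : Xs ≠ [] := by
  rintro rfl
  obtain ⟨xs, ⟨hm, -⟩, ha, -⟩ := h
  simp [List.forall₂_nil_right_iff.1 hm] at ha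

theorem Spans.exists_mem_head {Xs : List (Set Node)} {a b : Node} (h : Spans Xs a b) :
    ∃ A ∈ Xs, ∀ c d, Spans Xs c d → c ∈ A := by
  obtain ⟨A, As, rfl⟩ := List.exists_cons_of_ne_nil h.ne_nil
  exact ⟨A, by simp, fun _ _ h => h.mem_head⟩

theorem Spans.exists_mem_getLast {Xs : List (Set Node)} {a b : Node} (h : Spans Xs a b) :
    ∃ B ∈ Xs, ∀ c d, Spans Xs c d → d ∈ B := by
  obtain ⟨As, B, rfl⟩ := (List.eq_nil_or_concat' Xs).resolve_left h.ne_nil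
  exact ⟨B, by simp, fun _ _ h => h.mem_getLast⟩

theorem finite_spans {Xs : List (Set Node)} (hfin : ∀ X ∈ Xs, X.Finite) :
    {p : Node × Node | Spans Xs p.1 p.2}.Finite := by
  rcases Set.eq_empty_or_nonempty {p : Node × Node | Spans Xs p.1 p.2} with h | ⟨p, hp⟩
  · simp [h]
  · obtain ⟨A, hA, hA'⟩ := Spans.exists_mem_head hp
    obtain ⟨B, hB, hB'⟩ := Spans.exists_mem_getLast hp
    exact ((hfin A hA).prod (hfin B hB)).subset fun q hq => ⟨hA' _ _ hq, hB' _ _ hq⟩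

theorem mem_mop_iff {Xs : List (Set Node)} (hdeep : ∀ X ∈ Xs, DeepSet X) (p : Node × Node) :
    p ∈ Mop Xs ↔ IsMinPair LeftOf (Spans Xs) p.1 p.2 := by
  refine and_congr_right fun (hp : Spans Xs p.1 p.2) => ?_
  obtain ⟨A, hA, hA'⟩ := hp.exists_mem_head
  obtain ⟨B, hB, hB'⟩ := hp.exists_mem_getLast
  have hle₁ {c d} (h : Spans Xs c d) :=
    (hdeep A hA).leftOrAbove_iff (hA' _ _ hp) (hA' _ _ h)
  have hle₂ {c d} (h : Spans Xs c d) :=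
    (hdeep B hB).leftOrAbove_iff (hB' _ _ h) (hB' _ _ hp)
  constructor
  · rintro hno c d h hn
    have hlt : LeftOf c d := by
      obtain ⟨X, Ys, rfl⟩ := List.exists_cons_of_ne_nil hp.ne_nil
      rcases eq_or_ne Ys [] with rfl | hne
      · obtain ⟨-, rfl⟩ := (spans_singleton X c d).1 h
        obtain ⟨-, hpp⟩ := (spans_singleton X _ _).1 hp
        rw [hpp] at hn
        have := not_leftOf_self p.1
        have := @LeftOf.trans p.1 d p.1
        simp only [Narrower] at hn
        grind
      · exact h.leftOf hne
    obtain ⟨ys, hys, hc, hd⟩ := id h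
    refine hno ⟨ys, c, d, hys, hc, hd, ?_⟩
    rw [hle₁ h, hle₂ h]
    simp only [Narrower] at hn
    tauto
  · rintro hno ⟨ys, c, d, hys, hc, hd, h⟩
    have hs : Spans Xs c d := ⟨ys, hys, hc, hd⟩
    rw [hle₁ hs, hle₂ hs] at h
    refine hno c d hs ?_
    simp only [Narrower]
    tauto

theorem spans_trichotomy_fst {Xs : List (Set Node)} (hdeep : ∀ X ∈ Xs, DeepSet X)
    {a b c d : Node} (h : Spans Xs a b) (h' : Spans Xs c d) :
    LeftOf a c ∨ a = c ∨ LeftOf c a := by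
  obtain ⟨A, hA, hA'⟩ := h.exists_mem_head
  exact (hdeep A hA).leftOf_trichotomy (hA' _ _ h) (hA' _ _ h')

theorem spans_trichotomy_snd {Xs : List (Set Node)} (hdeep : ∀ X ∈ Xs, DeepSet X)
    {a b c d : Node} (h : Spans Xs a b) (h' : Spans Xs c d) :
    LeftOf b d ∨ b = d ∨ LeftOf d b := by
  obtain ⟨B, hB, hB'⟩ := h.exists_mem_getLast
  exact (hdeep B hB).leftOf_trichotomy (hB' _ _ h) (hB' _ _ h')

theorem mop_singleton {X : Set Node} (hX : DeepSet X) :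
    Mop [X] = {p | p.1 ∈ X ∧ p.2 = p.1} := by
  ext ⟨a, b⟩
  rw [mem_mop_iff (by simpa using hX)]
  simp only [IsMinPair, spans_singleton, Set.mem_ofPred_eq, and_iff_left_iff_imp]
  rintro ⟨-, rfl⟩ c d ⟨-, rfl⟩ hn
  have := not_leftOf_self b
  have := @LeftOf.trans b d b
  simp only [Narrower] at hn
  grind

theorem deepSet_snd_image_mop {Xs : List (Set Node)} (hdeep : ∀ X ∈ Xs, DeepSet X) :
    DeepSet (Prod.snd '' Mop Xs) := by
  rintro _ ⟨p, hp, rfl⟩ _ ⟨q, hq, rfl⟩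
  obtain ⟨B, hB, hB'⟩ := Spans.exists_mem_getLast hp.1
  exact hdeep B hB _ (hB' _ _ hp.1) _ (hB' _ _ hq.1)

theorem deepSet_fst_image_mop {Xs : List (Set Node)} (hdeep : ∀ X ∈ Xs, DeepSet X) :
    DeepSet (Prod.fst '' Mop Xs) := by
  rintro _ ⟨p, hp, rfl⟩ _ ⟨q, hq, rfl⟩
  obtain ⟨A, hA, hA'⟩ := Spans.exists_mem_head hp.1
  exact hdeep A hA _ (hA' _ _ hp.1) _ (hA' _ _ hq.1)

theorem mop_append {Xs : List (Set Node)} {C : Set Node} (hXs : Xs ≠ [])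
    (hdeep : ∀ X ∈ Xs, DeepSet X) (hfin : ∀ X ∈ Xs, X.Finite) (hC : DeepSet C) :
    Mop (Xs ++ [C]) = MopRight (Mop Xs) C := by
  ext ⟨a, c⟩
  have hY := deepSet_snd_image_mop hdeep
  rw [mem_mop_iff (by simpa [or_imp, forall_and] using ⟨hdeep, hC⟩)]
  have hspans : Spans (Xs ++ [C]) = fun a c => ∃ b, Spans Xs a b ∧ c ∈ C ∧ LeftOf b c := by
    ext a c
    exact spans_append hXs C a c
  have hpair : Spans [Prod.snd '' Mop Xs, C] =
      fun b c => (∃ a, IsMinPair LeftOf (Spans Xs) a b) ∧ c ∈ C ∧ LeftOf b c := by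
    ext b c
    simp [spans_cons, spans_singleton, mem_mop_iff hdeep]
    grind
  rw [hspans]
  refine (isMinPair_comp_right (lt := LeftOf) (C := (· ∈ C)) LeftOf.trans not_leftOf_self
    (finite_spans hfin) (spans_trichotomy_fst hdeep)
    (spans_trichotomy_snd hdeep) a c).trans ?_
  refine exists_congr fun b => and_congr (mem_mop_iff hdeep (a, b)).symm ?_
  rw [mem_mop_iff (by simpa using ⟨hY, hC⟩), hpair]

theorem mop_cons {Xs : List (Set Node)} {C : Set Node} (hXs : Xs ≠ [])
    (hdeep : ∀ X ∈ Xs, DeepSet X) (hfin : ∀ X ∈ Xs, X.Finite) (hC : DeepSet C) :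
    Mop (C :: Xs) = MopLeft C (Mop Xs) := by
  ext ⟨c, b⟩
  have hY := deepSet_fst_image_mop hdeep
  rw [mem_mop_iff (by simpa using ⟨hC, hdeep⟩)]
  have hspans : Spans (C :: Xs) = fun c b => ∃ a, Spans Xs a b ∧ c ∈ C ∧ LeftOf c a := by
    ext c b
    exact spans_cons hXs C c b
  have hpair : Spans [C, Prod.fst '' Mop Xs] =
      fun c a => (∃ b, IsMinPair LeftOf (Spans Xs) a b) ∧ c ∈ C ∧ LeftOf c a := by
    ext c a
    simp [spans_cons, spans_singleton, mem_mop_iff hdeep]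
  rw [hspans]
  refine (isMinPair_comp_left (lt := LeftOf) (C := (· ∈ C)) LeftOf.trans not_leftOf_self
    (finite_spans hfin) (spans_trichotomy_fst hdeep)
    (spans_trichotomy_snd hdeep) c b).trans ?_
  refine exists_congr fun a => and_congr (mem_mop_iff hdeep (a, b)).symm ?_
  rw [mem_mop_iff (by simpa using ⟨hC, hY⟩), hpair]

theorem finite_pos (t : OTree α) : (Pos t).Finite := by
  obtain ⟨a, cs⟩ := t
  have hsub : Pos (node a cs) ⊆
      {[]} ∪ ⋃ i : Fin cs.length, List.cons i.1 '' Pos cs[i.1] := by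
    rintro (_ | ⟨i, p⟩) hp
    · simp
    · by_cases hi : i < cs.length
      · refine .inr (Set.mem_iUnion.2 ⟨⟨i, hi⟩, p, ?_, rfl⟩)
        simpa [Pos, sub, children, hi] using hp
      · simp [Pos, sub, children, hi] at hp
  refine ((Set.finite_singleton _).union (Set.finite_iUnion fun i => ?_)).subset hsub
  exact (finite_pos cs[i.1]).image _
termination_by sizeOf t
decreasing_by
  have := List.sizeOf_lt_of_mem (List.getElem_mem i.2)
  simp only [OTree.node.sizeOf_spec]
  omega

/-- (Proposition 2) The sequences `U_i` computed via `MopRight` and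
`V_i` computed via `MopLeft` are the corresponding `mop` sets. -/
theorem mopRight_mopLeft_compute_mop {α : Type} (T : OTree α)
    (k j : ℕ) (X : ℕ → Set Node)
    (hk : 2 ≤ k) (hj1 : 1 ≤ j) (hjk : j ≤ k)
    (hdeep : ∀ i, 1 ≤ i → i ≤ k → DeepSet (X i))
    (hsub : ∀ i, 1 ≤ i → i ≤ k → X i ⊆ Pos T)
    (U V : ℕ → Set (Node × Node))
    (hUj : U j = {p | p.1 ∈ X j ∧ p.2 = p.1})
    (hUstep : ∀ i, j < i → i ≤ k → U i = MopRight (U (i - 1)) (X i))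
    (hVj : V j = U k)
    (hVstep : ∀ i, 1 ≤ i → i < j → V i = MopLeft (X i) (V (i + 1))) :
    (∀ l, j + 1 ≤ l → l ≤ k →
        U l = Mop ((List.range (l - j + 1)).map (fun d => X (j + d)))) ∧
    (∀ l, 1 ≤ l → l ≤ j - 1 →
        V l = Mop ((List.range (k - l + 1)).map (fun d => X (l + d)))) := by
  have hmem {a n : ℕ} (ha : 1 ≤ a) (han : a + n ≤ k) :
      ∀ Y ∈ (List.range (n + 1)).map (fun d => X (a + d)), DeepSet Y ∧ Y.Finite := by
    intro Y hY
    obtain ⟨d, hd, rfl⟩ := List.mem_map.1 hY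
    rw [List.mem_range] at hd
    exact ⟨hdeep _ (by omega) (by omega),
      (finite_pos T).subset (hsub _ (by omega) (by omega))⟩
  have hU : ∀ n, j + n ≤ k →
      U (j + n) = Mop ((List.range (n + 1)).map (fun d => X (j + d))) := by
    intro n
    induction n with
    | zero =>
      intro _
      simp [hUj, mop_singleton (hdeep j hj1 hjk)]
    | succ n ih =>
      intro hn
      rw [hUstep _ (by omega) hn, Nat.add_succ_sub_one, ih (by omega), List.range_succ (n := n + 1),
        List.map_append, List.map_singleton]
      have h := hmem hj1 (n := n) (by omega)
      exact (mop_append (by simp) (fun Y hY => (h Y hY).1) (fun Y hY => (h Y hY).2)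
        (hdeep _ (by omega) hn)).symm
  have hV : ∀ n, n < j →
      V (j - n) = Mop ((List.range (k - (j - n) + 1)).map (fun d => X (j - n + d))) := by
    intro n
    induction n with
    | zero =>
      intro _
      have := hU (k - j) (by omega)
      rw [Nat.add_sub_of_le hjk] at this
      rw [Nat.sub_zero, hVj, this]
    | succ n ih =>
      intro hn
      obtain ⟨m, hm⟩ : ∃ m, j - n = m + 1 := ⟨j - n - 1, by omega⟩
      have hm' : j - (n + 1) = m := by omega
      have hlen : k - m + 1 = k - (m + 1) + 1 + 1 := by omega
      have ih := ih (by omega)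
      rw [hm] at ih
      rw [hm', hVstep m (by omega) (by omega), ih, hlen, List.range_succ_eq_map (n := _ + 1),
        List.map_cons, List.map_map]
      have h := hmem (a := m + 1) (n := k - (m + 1)) (by omega) (by omega)
      rw [← mop_cons (by simp) (fun Y hY => (h Y hY).1) (fun Y hY => (h Y hY).2)
        (hdeep m (by omega) (by omega))]
      simp [Function.comp_def, add_assoc, add_comm 1]
  refine ⟨fun l hl hlk => ?_, fun l hl hlj => ?_⟩
  · have := hU (l - j) (by omega)
    rwa [Nat.add_sub_of_le (by omega)] at this
  · have := hV (j - l) (by omega)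
    rwa [Nat.sub_sub_self (by omega)] at this

end OTree

end TreeIncl
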